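/- Let G be a connected simple graph on a finite vertex set, let A be a symmetric relation on Fin n, and let r be an A-role colouring of G that is surjective onto Fin n. Then the role graph is connected: for any two colours a, b ∈ Fin n, b is reachable from a by a finite chain of A-related colours (i.e., the reflexive-transitive closure of A relates a and b). -/

import Mathlib

/-- An `A`-role colouring of `G`: the image of every open neighbourhood
equals the `A`-neighbourhood of the vertex's colour. -/
def IsRoleColoring {V : Type*} {n : ℕ} (G : SimpleGraph V)
    (A : Fin n → Fin n → Prop) (r : V → Fin n) : Prop :=
  ∀ v : V, r '' (G.neighborSet v) = {j : Fin n | A (r v) j}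

/-- A role colouring maps adjacent vertices to related colours. -/
theorem IsRoleColoring.rel_of_adj {V : Type*} {n : ℕ} {G : SimpleGraph V}
    {A : Fin n → Fin n → Prop} {r : V → Fin n} (hr : IsRoleColoring G A r)
    {u v : V} (h : G.Adj u v) : A (r u) (r v) :=
  (hr u).subset ⟨v, h, rfl⟩

/-- If a connected graph has a surjective `A`-role colouring, then the role
graph is connected: any two colours are related by the reflexive-transitive
closure of `A`. -/
theorem role_graph_connected {V : Type*} [Fintype V]
    (G : SimpleGraph V) (hG : G.Connected)
    (n : ℕ) (A : Fin n → Fin n → Prop) (hA : Symmetric A)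
    (r : V → Fin n) (hr : IsRoleColoring G A r)
    (hsurj : Function.Surjective r) :
    ∀ a b : Fin n, Relation.ReflTransGen A a b := by
  intro a b
  obtain ⟨u, rfl⟩ := hsurj a
  obtain ⟨v, rfl⟩ := hsurj b
  exact ((G.reachable_iff_reflTransGen u v).mp (hG.preconnected u v)).lift r
    fun _ _ h => hr.rel_of_adj h
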